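/- There exists a family of Boolean functions (f_n), f_n : {0,1}^n → {0,1}, such that size^ndc(f_n) ≤ 2n + o(n) and size^dc(f_n) = 3n − o(n); that is, there exist functions g(n) = o(n) and h(n) = o(n) with size^ndc(f_n) ≤ 2n + g(n) and 3n − h(n) ≤ size^dc(f_n) ≤ 3n. -/

import Mathlib

/-!
Common definitions: Boolean circuits (with AND/OR/NOT gates of fan-in ≤ 2 and
dummy COPY gates used only for layering), nondeterministic circuits with guess
inputs, width via layerings, nondeterministic branching programs, and
U₂-circuits with their deterministic/nondeterministic circuit complexities.
-/

/-- A node of a circuit with `n` actual inputs and `m` guess inputs.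
Gate nodes refer to their predecessors by (strictly smaller) indices. -/
inductive CNode (n m : ℕ) : Type where
  | actual : Fin n → CNode n m
  | guess  : Fin m → CNode n m
  | const  : Bool → CNode n m
  | gand   : ℕ → ℕ → CNode n m
  | gor    : ℕ → ℕ → CNode n m
  | gnot   : ℕ → CNode n m
  | gcopy  : ℕ → CNode n m
deriving DecidableEq

namespace CNode

/-- The predecessor indices of a node. -/
def preds {n m : ℕ} : CNode n m → List ℕ
  | gand j k => [j, k]
  | gor j k  => [j, k]
  | gnot j   => [j]
  | gcopy j  => [j]
  | _        => []

/-- Real gates (AND, OR, NOT); these are the gates counted in the size.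
COPY gates are dummy gates inserted only to make the circuit layered. -/
def isGate {n m : ℕ} : CNode n m → Bool
  | gand _ _ => true
  | gor _ _  => true
  | gnot _   => true
  | _        => false

/-- Nodes occupying space in a layer (real gates and COPY gates);
these are counted in the width of a layer. -/
def isWide {n m : ℕ} : CNode n m → Bool
  | gand _ _ => true
  | gor _ _  => true
  | gnot _   => true
  | gcopy _  => true
  | _        => false

end CNode

/-- A (nondeterministic) Boolean circuit with `n` actual inputs and `m` guess
inputs: a DAG whose in-degree-0 nodes are labeled by actual inputs, guess
inputs or constants, whose gates are AND/OR/NOT gates (plus dummy COPY gates),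
with a designated output node.  Each guess input labels at most one node. -/
structure Circuit (n m : ℕ) : Type where
  N : ℕ
  node : Fin N → CNode n m
  output : Fin N
  wf : ∀ i : Fin N, ∀ j ∈ (node i).preds, j < (i : ℕ)
  guessOnce : ∀ g : Fin m,
    (Finset.univ.filter (fun i : Fin N => node i = CNode.guess g)).card ≤ 1

namespace Circuit

variable {n m : ℕ}

def nodeAt (c : Circuit n m) (i : ℕ) : CNode n m :=
  if h : i < c.N then c.node ⟨i, h⟩ else CNode.const false

/-- The Boolean value computed at node `i` on actual inputs `x` and
guess inputs `y`. -/
def evalAux (c : Circuit n m) (x : Fin n → Bool) (y : Fin m → Bool) : ℕ → Bool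
  | i =>
    match c.nodeAt i with
    | CNode.actual a => x a
    | CNode.guess g => y g
    | CNode.const b => b
    | CNode.gand j k =>
        (if _h : j < i then c.evalAux x y j else false) &&
        (if _h : k < i then c.evalAux x y k else false)
    | CNode.gor j k =>
        (if _h : j < i then c.evalAux x y j else false) ||
        (if _h : k < i then c.evalAux x y k else false)
    | CNode.gnot j => !(if _h : j < i then c.evalAux x y j else false)
    | CNode.gcopy j => (if _h : j < i then c.evalAux x y j else false)
termination_by i => i

/-- The output value of the circuit. -/
def eval (c : Circuit n m) (x : Fin n → Bool) (y : Fin m → Bool) : Bool :=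
  c.evalAux x y c.output

/-- A nondeterministic circuit computes `f` if for every actual input `x`,
`f x = 1` iff some assignment of the guess inputs makes the circuit output 1.
(For `m = 0` this is the usual notion for deterministic circuits.) -/
def Computes (c : Circuit n m) (f : (Fin n → Bool) → Bool) : Prop :=
  ∀ x : Fin n → Bool, f x = true ↔ ∃ y : Fin m → Bool, c.eval x y = true

/-- The size of a circuit: the number of (non-COPY) gates. -/
def size (c : Circuit n m) : ℕ :=
  (Finset.univ.filter (fun i : Fin c.N => (c.node i).isGate = true)).card

/-- `ℓ` is a layering of the circuit: every wire goes between adjacent layers. -/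
def IsLayering (c : Circuit n m) (ℓ : Fin c.N → ℕ) : Prop :=
  ∀ i : Fin c.N, ∀ j ∈ (c.node i).preds, ∀ hj : j < c.N, ℓ ⟨j, hj⟩ + 1 = ℓ i

/-- The circuit has width at most `w`: there is a layering in which every layer
contains at most `w` gates (real gates and COPY gates). -/
def HasWidth (c : Circuit n m) (w : ℕ) : Prop :=
  ∃ ℓ : Fin c.N → ℕ, c.IsLayering ℓ ∧
    ∀ t : ℕ,
      (Finset.univ.filter
        (fun i : Fin c.N => ℓ i = t ∧ (c.node i).isWide = true)).card ≤ w

/-- The circuit is read-`k`-times: every actual input labels at most `k` nodes. -/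
def ReadK (c : Circuit n m) (k : ℕ) : Prop :=
  ∀ a : Fin n,
    (Finset.univ.filter (fun i : Fin c.N => c.node i = CNode.actual a)).card ≤ k

/-- The maximal number of (non-COPY) gates on a path ending at node `i`. -/
def depthAux (c : Circuit n m) : ℕ → ℕ
  | i =>
    match c.nodeAt i with
    | CNode.actual _ => 0
    | CNode.guess _ => 0
    | CNode.const _ => 0
    | CNode.gand j k =>
        max (if _h : j < i then c.depthAux j else 0)
            (if _h : k < i then c.depthAux k else 0) + 1
    | CNode.gor j k =>
        max (if _h : j < i then c.depthAux j else 0)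
            (if _h : k < i then c.depthAux k else 0) + 1
    | CNode.gnot j => (if _h : j < i then c.depthAux j else 0) + 1
    | CNode.gcopy j => (if _h : j < i then c.depthAux j else 0)
termination_by i => i

/-- The depth of a circuit: the maximal number of gates on a directed path
from an input to the output. -/
def depth (c : Circuit n m) : ℕ := c.depthAux c.output

end Circuit

/-- A nondeterministic branching program on `n` Boolean variables: a DAG whose
inner nodes are labeled by variables with outgoing edges labeled 0 or 1 (edges
go to strictly larger indices), whose sinks are labeled 0 or 1, with a
designated start node. -/
structure NBP (n : ℕ) : Type where
  N : ℕ
  label : Fin N → Fin n ⊕ Bool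
  edges : Fin N → Bool → Finset (Fin N)
  start : Fin N
  wf : ∀ i : Fin N, ∀ b : Bool, ∀ j ∈ edges i b,
        (i : ℕ) < (j : ℕ) ∧ (label i).isLeft

namespace NBP

variable {n : ℕ}

/-- The size of a branching program: the number of its nodes. -/
def size (B : NBP n) : ℕ := B.N

/-- On input `x`, some path from node `i` consistent with `x` reaches a 1-sink. -/
def AccFrom (B : NBP n) (x : Fin n → Bool) : Fin B.N → Prop
  | i =>
    match B.label i with
    | Sum.inr b => b = true
    | Sum.inl v => ∃ j ∈ B.edges i (x v), ∃ _h : (i : ℕ) < (j : ℕ), B.AccFrom x j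
termination_by i => B.N - (i : ℕ)
decreasing_by
  have := j.isLt
  omega

/-- A nondeterministic branching program computes `f` if for every `x`,
`f x = 1` iff at least one path consistent with `x` leads to a 1-sink. -/
def Computes (B : NBP n) (f : (Fin n → Bool) → Bool) : Prop :=
  ∀ x : Fin n → Bool, f x = true ↔ B.AccFrom x B.start

/-- A (syntactic) path in the underlying graph of the branching program. -/
def IsPath (B : NBP n) : List (Fin B.N) → Prop
  | [] => True
  | [_] => True
  | i :: j :: p => (∃ b : Bool, j ∈ B.edges i b) ∧ B.IsPath (j :: p)

/-- The branching program is syntactic read-`k`-times: every variable appears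
at most `k` times on each path. -/
def SyntacticReadK (B : NBP n) (k : ℕ) : Prop :=
  ∀ p : List (Fin B.N), B.IsPath p → ∀ v : Fin n,
    (p.countP fun i => decide (B.label i = Sum.inl v)) ≤ k

end NBP

/-- A node of a `U₂`-circuit.  A gate `gate a b c j k` computes
`((vⱼ ⊕ a) ∧ (v_k ⊕ b)) ⊕ c` from the values `vⱼ, v_k` of its two
predecessors; these are exactly the Boolean functions in `U₂`
(all two-variable Boolean functions except XOR and its complement). -/
inductive U2Node (n m : ℕ) : Type where
  | actual : Fin n → U2Node n m
  | guess  : Fin m → U2Node n m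
  | const  : Bool → U2Node n m
  | gate   : Bool → Bool → Bool → ℕ → ℕ → U2Node n m
deriving DecidableEq

namespace U2Node

def isGate {n m : ℕ} : U2Node n m → Bool
  | gate _ _ _ _ _ => true
  | _ => false

end U2Node

/-- A (nondeterministic) `U₂`-circuit with `n` actual inputs and `m` guess
inputs: every gate has fan-in 2 and is labeled by a function in `U₂`. -/
structure U2Circuit (n m : ℕ) : Type where
  N : ℕ
  node : Fin N → U2Node n m
  output : Fin N
  wf : ∀ i : Fin N, ∀ a b c j k,
        node i = U2Node.gate a b c j k → j < (i : ℕ) ∧ k < (i : ℕ)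

namespace U2Circuit

variable {n m : ℕ}

def nodeAt (c : U2Circuit n m) (i : ℕ) : U2Node n m :=
  if h : i < c.N then c.node ⟨i, h⟩ else U2Node.const false

def evalAux (c : U2Circuit n m) (x : Fin n → Bool) (y : Fin m → Bool) : ℕ → Bool
  | i =>
    match c.nodeAt i with
    | U2Node.actual a => x a
    | U2Node.guess g => y g
    | U2Node.const b => b
    | U2Node.gate a b cc j k =>
        xor
          ((xor (if _h : j < i then c.evalAux x y j else false) a) &&
           (xor (if _h : k < i then c.evalAux x y k else false) b))
          cc
termination_by i => i

def eval (c : U2Circuit n m) (x : Fin n → Bool) (y : Fin m → Bool) : Bool :=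
  c.evalAux x y c.output

/-- A nondeterministic `U₂`-circuit computes `f` if for every actual input `x`,
`f x = 1` iff some assignment of the guess inputs makes the circuit output 1. -/
def Computes (c : U2Circuit n m) (f : (Fin n → Bool) → Bool) : Prop :=
  ∀ x : Fin n → Bool, f x = true ↔ ∃ y : Fin m → Bool, c.eval x y = true

/-- The size of a `U₂`-circuit: the number of its gates. -/
def size (c : U2Circuit n m) : ℕ :=
  (Finset.univ.filter (fun i : Fin c.N => (c.node i).isGate = true)).card

end U2Circuit

/-- `size^dc f`: the size of the smallest deterministic `U₂`-circuit
computing `f`. -/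
noncomputable def sizeDC {n : ℕ} (f : (Fin n → Bool) → Bool) : ℕ :=
  sInf {s : ℕ | ∃ c : U2Circuit n 0, c.Computes f ∧ c.size = s}

/-- `size^ndc f`: the size of the smallest nondeterministic `U₂`-circuit
computing `f`. -/
noncomputable def sizeNDC {n : ℕ} (f : (Fin n → Bool) → Bool) : ℕ :=
  sInf {s : ℕ | ∃ m : ℕ, ∃ c : U2Circuit n m, c.Computes f ∧ c.size = s}

/-- The parity function: `parityFun n x = 1` iff `Σ xᵢ ≡ 1 (mod 2)`. -/
def parityFun (n : ℕ) : (Fin n → Bool) → Bool :=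
  fun x => decide ((∑ i : Fin n, (x i).toNat) % 2 = 1)

theorem blockIdx_lt {m : ℕ} (i j : Fin m) : m * (i : ℕ) + (j : ℕ) < m * m := by
  have hi := i.isLt
  have hj := j.isLt
  nlinarith

/-- The disjunction of the parities of the `m` consecutive blocks of `m`
variables:
`⋁_{i=0}^{m-1} Parity_m (x_{m·i+1}, …, x_{m·i+m})` on `n = m²` variables. -/
def blockParityOr (m : ℕ) : (Fin (m * m) → Bool) → Bool :=
  fun x => decide (∃ i : Fin m,
    parityFun m (fun j => x ⟨m * (i : ℕ) + (j : ℕ), blockIdx_lt i j⟩) = true)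

/-- Functions that are, up to negation, a constant, a variable in `A`, or a member of `S`. -/
def literals {ι : Type*} (A : Finset ι) (S : Set ((ι → Bool) → Bool)) :
    Set ((ι → Bool) → Bool) :=
  {f | (∃ b, f = fun _ => b) ∨ (∃ i ∈ A, ∃ b, f = fun x => xor (x i) b) ∨
    ∃ g ∈ S, ∃ b, f = fun x => xor (g x) b}

/-- `f` is the conjunction of two literals over `A` and `S`. -/
def IsAndOf {ι : Type*} (A : Finset ι) (S : Set ((ι → Bool) → Bool))
    (f : (ι → Bool) → Bool) : Prop :=
  ∃ u ∈ literals A S, ∃ v ∈ literals A S, f = fun x => u x && v x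

/-- Some and-inverter circuit with `s` gates over the variables in `A` computes, up to negation,
every function in `S`. -/
def Cover {ι : Type*} (A : Finset ι) (s : ℕ) (S : Set ((ι → Bool) → Bool)) : Prop :=
  ∃ g : ℕ → (ι → Bool) → Bool, (∀ k < s, IsAndOf A (g '' Set.Iio k) (g k)) ∧
    ∀ f ∈ S, f ∈ literals A (g '' Set.Iio s)

/-- Substitution of the constant `c` for the variable `i`. -/
def fixVar {ι : Type*} [DecidableEq ι] (i : ι) (c : Bool) (f : (ι → Bool) → Bool) :
    (ι → Bool) → Bool :=
  fun x => f (Function.update x i c)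

section Literals

variable {ι : Type*} {A : Finset ι} {S T : Set ((ι → Bool) → Bool)} {f : (ι → Bool) → Bool}

theorem const_mem_literals (b : Bool) : (fun _ => b) ∈ literals A S := Or.inl ⟨b, rfl⟩

theorem mem_literals_of_mem (h : f ∈ S) : f ∈ literals A S :=
  Or.inr (Or.inr ⟨f, h, false, by simp⟩)

theorem xor_mem_literals (h : f ∈ literals A S) (b : Bool) :
    (fun x => xor (f x) b) ∈ literals A S := by
  rcases h with ⟨c, rfl⟩ | ⟨i, hi, c, rfl⟩ | ⟨g, hg, c, rfl⟩
  · exact Or.inl ⟨xor c b, rfl⟩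
  · exact Or.inr (Or.inl ⟨i, hi, xor c b, by simp⟩)
  · exact Or.inr (Or.inr ⟨g, hg, xor c b, by simp⟩)

theorem literals_subset (h : S ⊆ literals A T) : literals A S ⊆ literals A T := by
  rintro f (hb | hi | ⟨g, hg, b, rfl⟩)
  · exact Or.inl hb
  · exact Or.inr (Or.inl hi)
  · exact xor_mem_literals (h hg) b

theorem literals_mono (h : S ⊆ T) : literals A S ⊆ literals A T :=
  literals_subset fun _ hf => mem_literals_of_mem (h hf)

theorem fixVar_mem_literals [DecidableEq ι] (i : ι) (c : Bool) (h : f ∈ literals A S) :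
    fixVar i c f ∈ literals (A.erase i) (fixVar i c '' S) := by
  rcases h with ⟨b, rfl⟩ | ⟨j, hj, b, rfl⟩ | ⟨g, hg, b, rfl⟩
  · exact const_mem_literals b
  · by_cases hij : j = i
    · subst hij
      exact Or.inl ⟨xor c b, by funext x; simp [fixVar]⟩
    · exact Or.inr (Or.inl ⟨j, Finset.mem_erase.2 ⟨hij, hj⟩, b, by
        funext x; simp [fixVar, hij]⟩)
  · exact Or.inr (Or.inr ⟨_, ⟨g, hg, rfl⟩, b, rfl⟩)

theorem and_mem_literals_of_const {u v : (ι → Bool) → Bool} (hv : v ∈ literals A S)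
    (hu : ∃ b, u = fun _ => b) : (fun x => u x && v x) ∈ literals A S := by
  obtain ⟨b, rfl⟩ := hu
  cases b
  · simpa using const_mem_literals false
  · simpa using hv

end Literals

section Cover

variable {ι : Type*} {A : Finset ι} {S T : Set ((ι → Bool) → Bool)} {f : (ι → Bool) → Bool}
  {s : ℕ}

theorem cover_empty : Cover A 0 ∅ := ⟨fun _ _ => false, by simp, by simp⟩

theorem Cover.of_subset_literals (h : Cover A s S) (hT : T ⊆ literals A S) : Cover A s T := by
  obtain ⟨g, hg, hS⟩ := h
  exact ⟨g, hg, fun f hf => literals_subset hS (hT hf)⟩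

theorem Cover.insert_literal (h : Cover A s S) (hf : f ∈ literals A S) :
    Cover A s (insert f S) :=
  h.of_subset_literals (Set.insert_subset hf fun _ => mem_literals_of_mem)

theorem Cover.insert_and (h : Cover A s S) (hf : IsAndOf A S f) :
    Cover A (s + 1) (insert f S) := by
  obtain ⟨g, hg, hS⟩ := h
  have himg : ∀ k ≤ s, Function.update g s f '' Set.Iio k = g '' Set.Iio k := by
    intro k hk
    refine Set.image_congr fun j hj => Function.update_of_ne ?_ _ _
    have : j < k := hj
    omega
  refine ⟨Function.update g s f, fun k hk => ?_, ?_⟩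
  · rw [himg k (by omega)]
    rcases Nat.lt_succ_iff_lt_or_eq.1 hk with hk | rfl
    · rw [Function.update_of_ne hk.ne]
      exact hg k hk
    · rw [Function.update_self]
      obtain ⟨u, hu, v, hv, rfl⟩ := hf
      exact ⟨u, literals_subset hS hu, v, literals_subset hS hv, rfl⟩
  · rintro t (rfl | ht)
    · exact mem_literals_of_mem ⟨s, by simp, by simp⟩
    · refine literals_mono ?_ (hS t ht)
      rw [← himg s le_rfl]
      exact Set.image_mono (Set.Iio_subset_Iio (Nat.le_succ s))

/-- Gates that are literals over the preceding ones need not be counted. -/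
theorem cover_of_redundant (h : ℕ → (ι → Bool) → Bool) (D : Finset ℕ) (s : ℕ)
    (hD : ∀ k < s, k ∈ D → h k ∈ literals A (h '' Set.Iio k))
    (hg : ∀ k < s, k ∉ D → IsAndOf A (h '' Set.Iio k) (h k)) :
    Cover A (Finset.range s \ D).card (h '' Set.Iio s) := by
  induction s with
  | zero => simpa using cover_empty
  | succ s ih =>
    have ih := ih (fun k hk => hD k (by omega)) (fun k hk => hg k (by omega))
    have himg : h '' Set.Iio (s + 1) = insert (h s) (h '' Set.Iio s) := by
      rw [← Set.image_insert_eq]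
      congr 1
      ext j
      simp only [Set.mem_Iio, Set.mem_insert_iff]
      omega
    rw [himg, Finset.range_add_one]
    by_cases hs : s ∈ D
    · rw [Finset.insert_sdiff_of_mem _ hs]
      exact ih.insert_literal (hD s (by omega) hs)
    · rw [Finset.insert_sdiff_of_notMem _ hs, Finset.card_insert_of_notMem (by simp)]
      exact ih.insert_and (hg s (by omega) hs)

theorem Cover.restrict [DecidableEq ι] (h : Cover A s {f}) (i : ι) (c : Bool) :
    Cover (A.erase i) s {fixVar i c f} := by
  obtain ⟨g, hg, hf⟩ := h
  have key := cover_of_redundant (A := A.erase i) (fun k => fixVar i c (g k)) ∅ s (by simp)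
    (fun k hk _ => by
      obtain ⟨u, hu, v, hv, huv⟩ := hg k hk
      rw [← Set.image_image]
      exact ⟨_, fixVar_mem_literals i c hu, _, fixVar_mem_literals i c hv, by rw [huv]; rfl⟩)
  rw [Finset.sdiff_empty, Finset.card_range, ← Set.image_image] at key
  exact key.of_subset_literals
    (Set.singleton_subset_iff.2 (fixVar_mem_literals i c (hf f rfl)))

end Cover

/-- Schnorr's gate elimination: if after fixing any variable in `A` the function still depends on
every other variable in `A`, then some substitution removes at least three gates. -/
theorem Cover.exists_fixVar {ι : Type*} [DecidableEq ι] {A : Finset ι} {f : (ι → Bool) → Bool}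
    {s : ℕ} (hA : 2 ≤ A.card)
    (hdep : ∀ i ∈ A, ∀ j ∈ A, i ≠ j → ∀ b, ∃ x : ι → Bool, x j = b ∧
      f (Function.update x i true) ≠ f (Function.update x i false))
    (hs : Cover A s {f}) :
    ∃ i ∈ A, ∃ c t, t + 3 ≤ s ∧ Cover (A.erase i) t {fixVar i c f} := by
  classical
  have hex : ∃ s, Cover A s {f} := ⟨s, hs⟩
  suffices H : ∀ s, Cover A s {f} → (∀ t < s, ¬ Cover A t {f}) →
      ∃ i ∈ A, ∃ c t, t + 3 ≤ s ∧ Cover (A.erase i) t {fixVar i c f} by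
    obtain ⟨i, hi, c, t, ht, h⟩ := H _ (Nat.find_spec hex) fun t ht => Nat.find_min hex ht
    exact ⟨i, hi, c, t, ht.trans (Nat.find_min' hex hs), h⟩
  clear hex hs s
  rintro s ⟨g, hg, hf⟩ hmin
  replace hf := hf f rfl
  choose! u hu v hv huv using hg
  -- no restriction of `f` is constant
  have hnc : ∀ i ∈ A, ∀ c b, fixVar i c f ≠ fun _ => b := by
    intro i hi c b heq
    obtain ⟨j, hj, hji⟩ := Finset.exists_mem_ne (by omega : 1 < A.card) i
    obtain ⟨x, hx, hne⟩ := hdep j hj i hi hji c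
    have hb : ∀ d, f (Function.update x j d) = b := by
      intro d
      have := congrFun heq (Function.update x j d)
      rwa [fixVar, Function.update_eq_self_iff.2] at this
      rw [Function.update_of_ne hji.symm, hx]
    exact hne (by rw [hb, hb])
  have hnonempty : A.Nonempty := Finset.card_pos.1 (by omega)
  have hf0 : f ∉ literals A ∅ := by
    rintro (⟨b, hb⟩ | ⟨i, hi, b, hb⟩ | ⟨g, hg, -⟩)
    · obtain ⟨i, hi⟩ := hnonempty
      exact hnc i hi false b (by rw [hb]; rfl)
    · exact hnc i hi false b (by rw [hb]; funext x; simp [fixVar])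
    · exact hg
  have hspos : 0 < s := by
    rcases Nat.eq_zero_or_pos s with rfl | h
    · exact absurd (by simpa using hf) hf0
    · exact h
  -- by minimality no gate is redundant
  have hdel : ∀ p < s, ∀ h : ℕ → (ι → Bool) → Bool, h p ∈ literals A (h '' Set.Iio p) →
      (∀ k < s, k ≠ p → IsAndOf A (h '' Set.Iio k) (h k)) →
      f ∉ literals A (h '' Set.Iio s) := by
    intro p hp h hpl hk hfl
    have key := cover_of_redundant (A := A) h {p} s
      (fun k _ hkp => by rw [Finset.mem_singleton.1 hkp]; exact hpl)
      (fun k hks hkp => hk k hks (by simpa using hkp))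
    refine hmin _ ?_ (key.of_subset_literals (Set.singleton_subset_iff.2 hfl))
    rw [Finset.card_sdiff_of_subset (by simpa using hp)]
    simp
    omega
  have hand : ∀ k < s, IsAndOf A (g '' Set.Iio k) (g k) :=
    fun k hk => ⟨u k, hu k hk, v k, hv k hk, huv k hk⟩
  have hg0 : g 0 ∉ literals A ∅ := by
    intro h0
    exact hdel 0 hspos g (by simpa using h0) (fun k hk _ => hand k hk) hf
  -- every gate other than the output is read by a later gate
  have hused : ∀ p < s, (∀ b, f ≠ fun x => xor (g p x) b) → ∃ k, p < k ∧ k < s ∧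
      ∃ b, (u k = fun x => xor (g p x) b) ∨ (v k = fun x => xor (g p x) b) := by
    intro p hp hfp
    by_contra! hcon
    have hlit : ∀ k w, w ∈ literals A (g '' Set.Iio k) → (∀ b, w ≠ fun x => xor (g p x) b) →
        w ∈ literals A (Function.update g p (fun _ => false) '' Set.Iio k) := by
      rintro k w (hb | hi | ⟨_, ⟨l, hl, rfl⟩, b, rfl⟩) hw
      · exact Or.inl hb
      · exact Or.inr (Or.inl hi)
      · have hlp : l ≠ p := by
          rintro rfl
          exact hw b rfl
        exact Or.inr (Or.inr ⟨g l, ⟨l, hl, Function.update_of_ne hlp _ _⟩, b, rfl⟩)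
    refine hdel p hp (Function.update g p fun _ => false) ?_ ?_ (hlit s f hf hfp)
    · rw [Function.update_self]
      exact const_mem_literals false
    · intro k hk hkp
      rw [Function.update_of_ne hkp]
      rcases lt_or_gt_of_ne hkp with hlt | hlt
      · have himg : Function.update g p (fun _ => false) '' Set.Iio k = g '' Set.Iio k := by
          refine Set.image_congr fun j hj => Function.update_of_ne ?_ _ _
          have : j < k := hj
          omega
        rw [himg]
        exact hand k hk
      · exact ⟨u k, hlit k _ (hu k hk) fun b => (hcon k hlt hk b).1,
          v k, hlit k _ (hv k hk) fun b => (hcon k hlt hk b).2, huv k hk⟩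
  -- the first gate reads two distinct variables
  obtain ⟨i, hi, a, j, hj, b, hij, hu0, hv0⟩ : ∃ i ∈ A, ∃ a, ∃ j ∈ A, ∃ b, i ≠ j ∧
      (u 0 = fun x => xor (x i) a) ∧ (v 0 = fun x => xor (x j) b) := by
    have hu' : u 0 ∈ literals A ∅ := by simpa using hu 0 hspos
    have hv' : v 0 ∈ literals A ∅ := by simpa using hv 0 hspos
    rw [huv 0 hspos] at hg0
    rcases id hu' with hc | ⟨i, hi, a, ha⟩ | ⟨_, h, -⟩
    · exact absurd (and_mem_literals_of_const hv' hc) hg0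
    · rcases id hv' with hc | ⟨j, hj, b, hb⟩ | ⟨_, h, -⟩
      · refine absurd (and_mem_literals_of_const hu' hc) ?_
        simpa only [Bool.and_comm] using hg0
      · refine ⟨i, hi, a, j, hj, b, ?_, ha, hb⟩
        rintro rfl
        rw [ha, hb] at hg0
        by_cases hab : a = b
        · subst hab
          simp only [Bool.and_self] at hg0
          exact hg0 (by rw [← ha]; exact hu')
        · refine hg0 (Or.inl ⟨false, ?_⟩)
          funext x
          cases x i <;> cases a <;> cases b <;> simp_all
      · exact absurd h (by simp)
    · exact absurd h (by simp)
  have hfix0 : fixVar i a (g 0) = fun _ => false := by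
    rw [huv 0 hspos, hu0]
    funext x
    simp [fixVar]
  have hfixi : ∀ b', ∃ c, fixVar i a (fun x => xor (x i) b') = fun _ => c :=
    fun b' => ⟨xor a b', by funext x; simp [fixVar]⟩
  -- another gate reads the variable `i`
  obtain ⟨k, hk0, hks, b', hk⟩ : ∃ k, 0 < k ∧ k < s ∧
      ∃ b', (u k = fun x => xor (x i) b') ∨ (v k = fun x => xor (x i) b') := by
    by_contra! hcon
    obtain ⟨x, hxj, hne⟩ := hdep i hi j hj hij b
    have hlit : ∀ k w, w ∈ literals A (g '' Set.Iio k) → (∀ b', w ≠ fun x => xor (x i) b') →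
        (∀ l < k, g l (Function.update x i true) = g l (Function.update x i false)) →
        w (Function.update x i true) = w (Function.update x i false) := by
      rintro k w (⟨c, rfl⟩ | ⟨l, hl, c, rfl⟩ | ⟨_, ⟨l, hl, rfl⟩, c, rfl⟩) hw ih
      · rfl
      · have hli : l ≠ i := by
          rintro rfl
          exact hw c rfl
        simp [hli]
      · simp [ih l hl]
    have hind : ∀ k < s, g k (Function.update x i true) = g k (Function.update x i false) := by
      intro k
      induction k using Nat.strong_induction_on with
      | _ k ih =>
        intro hks
        rcases Nat.eq_zero_or_pos k with rfl | hk0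
        · simp [huv 0 hspos, hv0, hij.symm, hxj]
        · have ih' := fun l hl => ih l hl (lt_trans hl hks)
          simp only [huv k hks]
          rw [hlit k (u k) (hu k hks) (fun b' => (hcon k hk0 hks b').1) ih',
            hlit k (v k) (hv k hks) (fun b' => (hcon k hk0 hks b').2) ih']
    refine hne (hlit s f hf (fun c hc => ?_) hind)
    exact hf0 (Or.inr (Or.inl ⟨i, hi, c, hc⟩))
  -- gates with a constant input become redundant
  have hred : ∀ k < s, (∃ c, fixVar i a (u k) = fun _ => c) ∨
      (∃ c, fixVar i a (v k) = fun _ => c) →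
      fixVar i a (g k) ∈
        literals (A.erase i) ((fun k => fixVar i a (g k)) '' Set.Iio k) := by
    intro k hk hc
    have hu' := fixVar_mem_literals i a (hu k hk)
    have hv' := fixVar_mem_literals i a (hv k hk)
    rw [Set.image_image] at hu' hv'
    rw [huv k hk]
    rcases hc with hc | hc
    · exact and_mem_literals_of_const hv' hc
    · have := and_mem_literals_of_const hu' hc
      rw [show fixVar i a (fun x => u k x && v k x) =
        fun x => fixVar i a (v k) x && fixVar i a (u k) x from
          funext fun x => Bool.and_comm _ _]
      exact this
  have hfin : ∀ k l, 0 < k → k < s → 0 < l → l < s → k ≠ l →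
      fixVar i a (g k) ∈
        literals (A.erase i) ((fun k => fixVar i a (g k)) '' Set.Iio k) →
      fixVar i a (g l) ∈
        literals (A.erase i) ((fun k => fixVar i a (g k)) '' Set.Iio l) →
      ∃ i ∈ A, ∃ c t, t + 3 ≤ s ∧ Cover (A.erase i) t {fixVar i c f} := by
    intro k l hk0 hks hl0 hls hkl hkr hlr
    have key := cover_of_redundant (A := A.erase i) (fun k => fixVar i a (g k))
      {0, k, l} s (fun p _ hp => by
        simp only [Finset.mem_insert, Finset.mem_singleton] at hp
        rcases hp with rfl | rfl | rfl
        · exact Or.inl ⟨false, hfix0⟩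
        · exact hkr
        · exact hlr)
      (fun p hps _ => by
        rw [← Set.image_image]
        exact ⟨_, fixVar_mem_literals i a (hu p hps), _, fixVar_mem_literals i a (hv p hps),
          by rw [huv p hps]; rfl⟩)
    have hcard : ({0, k, l} : Finset ℕ).card = 3 :=
      Finset.card_eq_three.2 ⟨0, k, l, hk0.ne, hl0.ne, hkl, rfl⟩
    have hsub : ({0, k, l} : Finset ℕ) ⊆ Finset.range s := by
      intro p hp
      simp only [Finset.mem_insert, Finset.mem_singleton] at hp
      rw [Finset.mem_range]
      omega
    have hle := Finset.card_le_card hsub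
    refine ⟨i, hi, a, _, ?_, key.of_subset_literals (Set.singleton_subset_iff.2 ?_)⟩
    · rw [Finset.card_sdiff_of_subset hsub]
      rw [Finset.card_range] at hle ⊢
      omega
    · rw [← Set.image_image]
      exact fixVar_mem_literals i a hf
  have hfixg : ∀ p c, (fixVar i a (g p) = fun _ => c) →
      ∀ b, ∃ c, fixVar i a (fun x => xor (g p x) b) = fun _ => c := by
    intro p c hp b
    refine ⟨xor c b, ?_⟩
    funext x
    have := congrFun hp x
    simp only [fixVar] at this ⊢
    rw [this]
  have hout : ∀ p c, (fixVar i a (g p) = fun _ => c) →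
      ∀ b, f ≠ fun x => xor (g p x) b := by
    intro p c hp b hfb
    obtain ⟨d, hd⟩ := hfixg p c hp b
    exact hnc i hi a d (by rw [hfb, hd])
  have hconst : ∀ p c, (fixVar i a (g p) = fun _ => c) → ∀ l < s,
      (∃ b, (u l = fun x => xor (g p x) b) ∨ (v l = fun x => xor (g p x) b)) →
      fixVar i a (g l) ∈
        literals (A.erase i) ((fun k => fixVar i a (g k)) '' Set.Iio l) := by
    rintro p c hp l hl ⟨b, h | h⟩
    · exact hred l hl (Or.inl (h ▸ hfixg p c hp b))
    · exact hred l hl (Or.inr (h ▸ hfixg p c hp b))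
  have hkred := hred k hks
    (hk.imp (fun h => by rw [h]; exact hfixi b') (fun h => by rw [h]; exact hfixi b'))
  obtain ⟨l, hl0, hls, d, hl⟩ := hused 0 hspos (hout 0 false hfix0)
  by_cases hkl : k = l
  · subst hkl
    have hne : ∀ d, (fun x : ι → Bool => xor (x i) b') ≠ fun x => xor (g 0 x) d := by
      intro d h
      refine hg0 (Or.inr (Or.inl ⟨i, hi, xor b' d, ?_⟩))
      funext x
      have := congrFun h x
      revert this
      cases x i <;> cases g 0 x <;> cases b' <;> cases d <;> simp
    have hboth : (∃ c, fixVar i a (u k) = fun _ => c) ∧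
        ∃ c, fixVar i a (v k) = fun _ => c := by
      rcases hk with hk | hk <;> rcases hl with hl | hl
      · exact absurd (hk.symm.trans hl) (hne d)
      · exact ⟨hk ▸ hfixi b', hl ▸ hfixg 0 false hfix0 d⟩
      · exact ⟨hl ▸ hfixg 0 false hfix0 d, hk ▸ hfixi b'⟩
      · exact absurd (hk.symm.trans hl) (hne d)
    obtain ⟨⟨c₁, h₁⟩, c₂, h₂⟩ := hboth
    have hgk : fixVar i a (g k) = fun _ => c₁ && c₂ := by
      rw [huv k hks]
      funext x
      exact congrArg₂ _ (congrFun h₁ x) (congrFun h₂ x)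
    obtain ⟨l, hkl, hls, hl⟩ := hused k hks (hout k _ hgk)
    exact hfin k l hk0 hks (hk0.trans hkl) hls hkl.ne hkred (hconst k _ hgk l hls hl)
  · exact hfin k l hk0 hks hl0 hls hkl hkred (hconst 0 _ hfix0 l hls ⟨d, hl⟩)

/-- A Boolean value as an element of `ZMod 2`. -/
def bitZ (b : Bool) : ZMod 2 := if b then 1 else 0

/-- The disjunction over the blocks `b ∈ B` of the parities, shifted by `p b`, of the variables
in `A` that belong to the block `b`. -/
def blockOr {ι κ : Type*} [DecidableEq κ] (blk : ι → κ) (A : Finset ι) (B : Finset κ)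
    (p : κ → ZMod 2) : (ι → Bool) → Bool :=
  fun x => decide (∃ b ∈ B, p b + ∑ i ∈ A with blk i = b, bitZ (x i) ≠ 0)

section BlockOr

variable {ι κ : Type*} [DecidableEq ι] [DecidableEq κ] {blk : ι → κ} {A : Finset ι}
  {B : Finset κ} {p : κ → ZMod 2}

theorem sum_bitZ_update_of_notMem {T : Finset ι} {i : ι} (hi : i ∉ T) (x : ι → Bool) (c : Bool) :
    ∑ j ∈ T, bitZ (Function.update x i c j) = ∑ j ∈ T, bitZ (x j) :=
  Finset.sum_congr rfl fun j hj => by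
    rw [Function.update_of_ne (ne_of_mem_of_not_mem hj hi)]

theorem sum_bitZ_update_of_mem {T : Finset ι} {i : ι} (hi : i ∈ T) (x : ι → Bool) (c : Bool) :
    ∑ j ∈ T, bitZ (Function.update x i c j) = bitZ c + ∑ j ∈ T.erase i, bitZ (x j) := by
  rw [← Finset.add_sum_erase _ _ hi, Function.update_self,
    sum_bitZ_update_of_notMem (Finset.notMem_erase i T)]

theorem fixVar_blockOr {i : ι} (hi : i ∈ A) (c : Bool) :
    fixVar i c (blockOr blk A B p) =
      blockOr blk (A.erase i) B (Function.update p (blk i) (p (blk i) + bitZ c)) := by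
  funext x
  simp only [fixVar, blockOr, decide_eq_decide]
  refine exists_congr fun b => and_congr_right fun _ => ?_
  rw [Finset.filter_erase]
  by_cases hb : blk i = b
  · subst hb
    rw [sum_bitZ_update_of_mem (by simp [hi]), Function.update_self, add_assoc]
  · rw [sum_bitZ_update_of_notMem (by simp [hb]), Function.update_of_ne (Ne.symm hb),
      Finset.erase_eq_of_notMem (by simp [hb])]

theorem fixVar_blockOr_of_singleton {j : ι} (hj : {i ∈ A | blk i = blk j} = {j}) {c : Bool}
    (hc : p (blk j) + bitZ c = 0) :
    fixVar j c (blockOr blk A B p) = blockOr blk (A.erase j) (B.erase (blk j)) p := by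
  funext x
  simp only [fixVar, blockOr, decide_eq_decide]
  refine exists_congr fun b => ?_
  rw [Finset.filter_erase, Finset.mem_erase, and_right_comm, and_comm (a := _ ∧ _), and_comm,
    and_comm (b := b ∈ B)]
  refine and_congr_right fun _ => ?_
  by_cases hb : b = blk j
  · subst hb
    simp [hj, hc]
  · rw [sum_bitZ_update_of_notMem (by simp [Ne.symm hb]),
      Finset.erase_eq_of_notMem (by simp [Ne.symm hb])]
    simp [hb]

theorem exists_sum_bitZ_eq {T : Finset ι} {r j : ι} (hr : r ∈ T) (hrj : r ≠ j) (c : Bool)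
    (z : ZMod 2) : ∃ x : ι → Bool, x j = c ∧ ∑ i ∈ T, bitZ (x i) = z := by
  have hz : ∀ y z : ZMod 2, ∃ d, bitZ d + y = z := by decide
  obtain ⟨d, hd⟩ := hz (∑ i ∈ T.erase r, bitZ (Function.update (fun _ => false) j c i)) z
  refine ⟨Function.update (Function.update (fun _ => false) j c) r d, ?_, ?_⟩
  · rw [Function.update_of_ne hrj.symm, Function.update_self]
  · rw [sum_bitZ_update_of_mem hr, hd]

theorem blockOr_dependence (hB : ∀ b ∈ B, 2 ≤ {i ∈ A | blk i = b}.card)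
    (hA : ∀ i ∈ A, blk i ∈ B) {i j : ι} (hi : i ∈ A) (c : Bool) :
    ∃ x : ι → Bool, x j = c ∧ blockOr blk A B p (Function.update x i true) ≠
      blockOr blk A B p (Function.update x i false) := by
  have hex : ∀ b, ∃ x : ι → Bool, x j = c ∧ (b ∈ B →
      p b + ∑ i ∈ A with blk i = b, bitZ (x i) = 0) := by
    intro b
    by_cases hb : b ∈ B
    · obtain ⟨r, hr, hrj⟩ := Finset.exists_mem_ne (hB b hb) j
      obtain ⟨x, hx, hs⟩ := exists_sum_bitZ_eq hr hrj c (-p b)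
      exact ⟨x, hx, fun _ => by rw [hs, add_neg_cancel]⟩
    · exact ⟨fun _ => c, rfl, fun h => absurd h hb⟩
  choose y hyj hy using hex
  have hx : ∀ b ∈ B, p b + ∑ i ∈ A with blk i = b, bitZ (y (blk i) i) = 0 := by
    intro b hb
    rw [← hy b hb]
    congr 1
    refine Finset.sum_congr rfl fun i hi => ?_
    rw [(Finset.mem_filter.1 hi).2]
  have hval : ∀ d, blockOr blk A B p (Function.update (fun i => y (blk i) i) i d) =
      decide (p (blk i) + (bitZ d +
        ∑ k ∈ {k ∈ A | blk k = blk i}.erase i, bitZ (y (blk k) k)) ≠ 0) := by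
    intro d
    simp only [blockOr, decide_eq_decide]
    constructor
    · rintro ⟨b, hb, hne⟩
      by_cases hbi : b = blk i
      · subst hbi
        rwa [sum_bitZ_update_of_mem (by simp [hi])] at hne
      · rw [sum_bitZ_update_of_notMem (by simp [Ne.symm hbi])] at hne
        exact absurd (hx b hb) hne
    · intro hne
      exact ⟨blk i, hA i hi, by rwa [sum_bitZ_update_of_mem (by simp [hi])]⟩
  refine ⟨fun i => y (blk i) i, hyj _, ?_⟩
  rw [hval, hval]
  have : ∀ q z : ZMod 2, decide (q + (bitZ true + z) ≠ 0) ≠ decide (q + (bitZ false + z) ≠ 0) := by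
    decide
  exact this _ _

/-- A circuit for a disjunction of block parities has at least three gates per variable, up to
three gates per block. -/
theorem Cover.card_le_of_blockOr {s : ℕ} (hB : ∀ b ∈ B, 2 ≤ {i ∈ A | blk i = b}.card)
    (hA : ∀ i ∈ A, blk i ∈ B) (hs : Cover A s {blockOr blk A B p}) :
    3 * A.card ≤ s + 3 * B.card := by
  induction hn : A.card using Nat.strong_induction_on generalizing A B p s with
  | _ n ih =>
    subst hn
    rcases A.eq_empty_or_nonempty with rfl | ⟨i₀, hi₀⟩
    · simp
    have hA2 : 2 ≤ A.card :=
      (hB _ (hA i₀ hi₀)).trans (Finset.card_le_card (Finset.filter_subset _ _))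
    obtain ⟨i, hi, c, t, ht, hcov⟩ := hs.exists_fixVar hA2
      fun i hi j _ _ b => blockOr_dependence hB hA hi b
    rw [fixVar_blockOr hi] at hcov
    set q := Function.update p (blk i) (p (blk i) + bitZ c) with hq
    have hcard := Finset.card_erase_add_one hi
    have hmem : i ∈ {k ∈ A | blk k = blk i} := by simp [hi]
    have hother : ∀ b ≠ blk i, {k ∈ A.erase i | blk k = b} = {k ∈ A | blk k = b} := by
      intro b hb
      rw [Finset.filter_erase, Finset.erase_eq_of_notMem (by simp [Ne.symm hb])]
    by_cases h3 : 3 ≤ {k ∈ A | blk k = blk i}.card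
    · have := ih _ (by omega) (fun b hb => ?_)
        (fun k hk => hA k (Finset.mem_of_mem_erase hk)) hcov rfl
      · omega
      · by_cases hbi : b = blk i
        · subst hbi
          rw [Finset.filter_erase, Finset.card_erase_of_mem hmem]
          omega
        · rw [hother b hbi]
          exact hB b hb
    · have h1 : ({k ∈ A.erase i | blk k = blk i}).card = 1 := by
        have := hB _ (hA i hi)
        rw [Finset.filter_erase, Finset.card_erase_of_mem hmem]
        omega
      obtain ⟨j, hj⟩ := Finset.card_eq_one.1 h1
      have hjfilter : j ∈ {k ∈ A.erase i | blk k = blk i} := by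
        rw [hj]
        exact Finset.mem_singleton_self j
      have hjmem := Finset.mem_filter.1 hjfilter
      have hz : ∀ z : ZMod 2, ∃ d, z + bitZ d = 0 := by decide
      obtain ⟨d, hd⟩ := hz (q (blk j))
      have hcov' := hcov.restrict j d
      rw [fixVar_blockOr_of_singleton (by rw [hjmem.2, hj]) hd, hjmem.2] at hcov'
      have hcard' := Finset.card_erase_add_one hjmem.1
      have hcardB := Finset.card_erase_add_one (hA i hi)
      have := ih _ (by omega) (fun b hb => ?_) (fun k hk => ?_) hcov' rfl
      · omega
      · have hbi := Finset.ne_of_mem_erase hb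
        rw [Finset.filter_erase, hother b hbi, Finset.erase_eq_of_notMem]
        · exact hB b (Finset.mem_of_mem_erase hb)
        · simp [hjmem.2, Ne.symm hbi]
      · have hk' := Finset.mem_of_mem_erase hk
        refine Finset.mem_erase.2 ⟨fun hki => ?_, hA k (Finset.mem_of_mem_erase hk')⟩
        have : k ∈ ({j} : Finset ι) := by
          rw [← hj]
          exact Finset.mem_filter.2 ⟨hk', hki⟩
        exact Finset.ne_of_mem_erase hk (Finset.mem_singleton.1 this)

end BlockOr
namespace U2Node

variable {n m : ℕ}

/-- The number of gates among the first `k` nodes of a sequence. -/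
def gateCount (nd : ℕ → U2Node n m) (k : ℕ) : ℕ :=
  {i ∈ Finset.range k | (nd i).isGate = true}.card

theorem gateCount_succ (nd : ℕ → U2Node n m) (k : ℕ) :
    gateCount nd (k + 1) = gateCount nd k + if (nd k).isGate = true then 1 else 0 := by
  simp only [gateCount, Finset.card_filter, Finset.sum_range_succ]

/-- The node `t` at position `i` computes the function `val i` of the actual and guess inputs,
provided its predecessors `j` compute `val j`. -/
def Spec (t : U2Node n m) (val : ℕ → (Fin n → Bool) × (Fin m → Bool) → Bool) (i : ℕ) : Prop :=
  match t with
  | actual a => val i = fun z => z.1 a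
  | guess g => val i = fun z => z.2 g
  | const b => val i = fun _ => b
  | gate a b c j k => j < i ∧ k < i ∧
      val i = fun z => xor (xor (val j z) a && xor (val k z) b) c

theorem Spec.congr {t : U2Node n m} {val val' : ℕ → (Fin n → Bool) × (Fin m → Bool) → Bool}
    {i : ℕ} (h : t.Spec val i) (hval : ∀ j ≤ i, val' j = val j) : t.Spec val' i := by
  cases t with
  | gate a b c j k =>
    obtain ⟨hj, hk, h⟩ := h
    refine ⟨hj, hk, ?_⟩
    rw [hval i le_rfl, hval j hj.le, hval k hk.le, h]
  | _ => exact (hval i le_rfl).trans h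

end U2Node

namespace U2Circuit

variable {n m : ℕ}

theorem nodeAt_coe (c : U2Circuit n m) (i : Fin c.N) : c.nodeAt i = c.node i := by
  simp [nodeAt]

theorem size_eq_gateCount (c : U2Circuit n m) : c.size = U2Node.gateCount c.nodeAt c.N := by
  rw [size, U2Node.gateCount, Finset.card_filter, Finset.card_filter,
    ← Fin.sum_univ_eq_sum_range (fun i => if (c.nodeAt i).isGate = true then 1 else 0)]
  simp only [nodeAt_coe]

theorem spec_evalAux (c : U2Circuit n m) {i : ℕ} (hi : i < c.N) :
    (c.nodeAt i).Spec (fun j z => c.evalAux z.1 z.2 j) i := by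
  have hwf : ∀ a b d j k, c.nodeAt i = U2Node.gate a b d j k → j < i ∧ k < i := by
    intro a b d j k h
    exact c.wf ⟨i, hi⟩ a b d j k (by rw [← h, ← nodeAt_coe])
  cases h : c.nodeAt i with
  | gate a b d j k =>
    obtain ⟨hj, hk⟩ := hwf _ _ _ _ _ h
    refine ⟨hj, hk, ?_⟩
    funext z
    beta_reduce
    rw [evalAux, h]
    simp [hj, hk]
  | _ =>
    funext z
    beta_reduce
    rw [evalAux, h]

theorem evalAux_eq_of_spec (c : U2Circuit n m)
    {val : ℕ → (Fin n → Bool) × (Fin m → Bool) → Bool}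
    (hval : ∀ i < c.N, (c.nodeAt i).Spec val i) (z : (Fin n → Bool) × (Fin m → Bool)) :
    ∀ i < c.N, c.evalAux z.1 z.2 i = val i z := by
  intro i
  induction i using Nat.strong_induction_on with
  | _ i ih =>
    intro hi
    have h := hval i hi
    have h' := c.spec_evalAux hi
    cases hn : c.nodeAt i with
    | gate a b d j k =>
      rw [hn] at h h'
      obtain ⟨hj, hk, h⟩ := h
      obtain ⟨-, -, h'⟩ := h'
      rw [h]
      beta_reduce
      rw [← ih j hj (hj.trans hi), ← ih k hk (hk.trans hi)]
      exact congrFun h' z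
    | _ =>
      rw [hn] at h h'
      exact (congrFun h' z).trans (congrFun h z).symm

theorem cover_evalAux (c : U2Circuit n 0) (y : Fin 0 → Bool) : ∀ k ≤ c.N,
    Cover Finset.univ (U2Node.gateCount c.nodeAt k)
      ((fun i x => c.evalAux x y i) '' Set.Iio k) := by
  intro k
  induction k with
  | zero => intro _; simpa [U2Node.gateCount] using cover_empty
  | succ k ih =>
    intro hk
    have ih := ih (by omega)
    have himg : (fun i x => c.evalAux x y i) '' Set.Iio (k + 1) =
        insert (fun x => c.evalAux x y k) ((fun i x => c.evalAux x y i) '' Set.Iio k) := by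
      rw [← Set.image_insert_eq (f := fun i x => c.evalAux x y i)]
      congr 1
      ext j
      simp only [Set.mem_Iio, Set.mem_insert_iff]
      omega
    have hspec := c.spec_evalAux (show k < c.N by omega)
    rw [himg, U2Node.gateCount_succ]
    cases hn : c.nodeAt k with
    | actual a =>
      rw [hn] at hspec
      refine ih.insert_literal (Or.inr (Or.inl ⟨a, Finset.mem_univ a, false, ?_⟩))
      funext x
      simpa using congrFun hspec (x, y)
    | guess g => exact g.elim0
    | const b =>
      rw [hn] at hspec
      exact ih.insert_literal (Or.inl ⟨b, funext fun x => congrFun hspec (x, y)⟩)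
    | gate a b d i j =>
      rw [hn] at hspec
      obtain ⟨hi, hj, hspec⟩ := hspec
      have hmem : ∀ i < k, (fun x => c.evalAux x y i) ∈
          literals Finset.univ ((fun i x => c.evalAux x y i) '' Set.Iio k) :=
        fun i hi => mem_literals_of_mem ⟨i, hi, rfl⟩
      have hand := ih.insert_and ⟨_, xor_mem_literals (hmem i hi) a, _,
        xor_mem_literals (hmem j hj) b, rfl⟩
      refine hand.of_subset_literals (Set.insert_subset ?_ ?_)
      · rw [show (fun x => c.evalAux x y k) = _ from funext fun x => congrFun hspec (x, y)]
        exact xor_mem_literals (mem_literals_of_mem (Set.mem_insert _ _)) d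
      · exact fun f hf => mem_literals_of_mem (Set.mem_insert_of_mem _ hf)

theorem Computes.cover {c : U2Circuit n 0} {f : (Fin n → Bool) → Bool} (h : c.Computes f) :
    Cover Finset.univ c.size {f} := by
  rw [size_eq_gateCount]
  refine (c.cover_evalAux Fin.elim0 c.N le_rfl).of_subset_literals ?_
  rw [Set.singleton_subset_iff]
  refine mem_literals_of_mem ⟨c.output, c.output.isLt, ?_⟩
  funext x
  rw [Bool.eq_iff_iff, h x]
  refine ⟨fun hx => ⟨_, hx⟩, ?_⟩
  rintro ⟨y, hy⟩
  rwa [Subsingleton.elim y Fin.elim0] at hy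

end U2Circuit

/-- Some sequence of `U₂`-circuit nodes with at most `s` gates computes every function in `S`. -/
def Realizes {n m : ℕ} (s : ℕ) (S : Set ((Fin n → Bool) × (Fin m → Bool) → Bool)) : Prop :=
  ∃ (N : ℕ) (nd : ℕ → U2Node n m) (val : ℕ → (Fin n → Bool) × (Fin m → Bool) → Bool),
    (∀ i < N, (nd i).Spec val i) ∧ U2Node.gateCount nd N ≤ s ∧ ∀ f ∈ S, ∃ i < N, val i = f

section Realizes

variable {n m s s' : ℕ} {S S' : Set ((Fin n → Bool) × (Fin m → Bool) → Bool)}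
  {f u v : (Fin n → Bool) × (Fin m → Bool) → Bool}

/-- The disjunction of the functions `w i` for `i ∈ T`. -/
def anyOf {α ι : Type*} (T : Finset ι) (w : ι → α → Bool) (z : α) : Bool :=
  decide (∃ i ∈ T, w i z = true)

theorem realizes_empty : Realizes (n := n) (m := m) 0 ∅ :=
  ⟨0, fun _ => U2Node.const false, fun _ _ => false, by simp, by simp [U2Node.gateCount], by simp⟩

theorem Realizes.mono (h : Realizes s S) (hs : s ≤ s') (hS : S' ⊆ S) : Realizes s' S' := by
  obtain ⟨N, nd, val, hspec, hcount, hval⟩ := h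
  exact ⟨N, nd, val, hspec, hcount.trans hs, fun f hf => hval f (hS hf)⟩

theorem Realizes.exists_circuit (h : Realizes s S) (hf : f ∈ S) :
    ∃ c : U2Circuit n m, c.size ≤ s ∧ ∀ x y, c.eval x y = f (x, y) := by
  obtain ⟨N, nd, val, hspec, hcount, hval⟩ := h
  obtain ⟨o, ho, rfl⟩ := hval f hf
  let c : U2Circuit n m :=
    { N := N
      node := fun i => nd i
      output := ⟨o, ho⟩
      wf := fun i a b d j k h => by
        have := hspec i i.isLt
        rw [h] at this
        exact ⟨this.1, this.2.1⟩ }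
  have hnode : ∀ i < N, c.nodeAt i = nd i := fun i hi => dif_pos hi
  refine ⟨c, ?_, fun x y => ?_⟩
  · rw [U2Circuit.size_eq_gateCount]
    refine le_trans (le_of_eq ?_) hcount
    refine congrArg Finset.card (Finset.filter_congr fun i hi => ?_)
    rw [hnode i (Finset.mem_range.1 hi)]
  · refine c.evalAux_eq_of_spec (fun i hi => ?_) (x, y) o ho
    rw [hnode i hi]
    exact hspec i hi

theorem exists_append {N : ℕ} {nd : ℕ → U2Node n m}
    {val : ℕ → (Fin n → Bool) × (Fin m → Bool) → Bool} (hspec : ∀ i < N, (nd i).Spec val i)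
    (hcount : U2Node.gateCount nd N ≤ s) (hval : ∀ f ∈ S, ∃ i < N, val i = f) (t : U2Node n m)
    (ht : t.Spec (Function.update val N f) N) :
    Realizes (s + if t.isGate = true then 1 else 0) (insert f S) := by
  refine ⟨N + 1, Function.update nd N t, Function.update val N f, fun i hi => ?_, ?_, ?_⟩
  · rcases Nat.lt_succ_iff_lt_or_eq.1 hi with hi | rfl
    · rw [Function.update_of_ne hi.ne]
      exact (hspec i hi).congr fun j hj => Function.update_of_ne (by omega) _ _
    · rwa [Function.update_self]
  · rw [U2Node.gateCount_succ, Function.update_self]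
    refine Nat.add_le_add_right (le_trans (le_of_eq ?_) hcount) _
    refine congrArg Finset.card (Finset.filter_congr fun i hi => ?_)
    rw [Function.update_of_ne (Finset.mem_range.1 hi).ne]
  · rintro g (rfl | hg)
    · exact ⟨N, by omega, Function.update_self _ _ _⟩
    · obtain ⟨i, hi, rfl⟩ := hval g hg
      exact ⟨i, by omega, Function.update_of_ne hi.ne _ _⟩

theorem Realizes.insert_actual (h : Realizes s S) (a : Fin n) :
    Realizes s (insert (fun z => z.1 a) S) := by
  obtain ⟨N, nd, val, hspec, hcount, hval⟩ := h
  exact exists_append hspec hcount hval (U2Node.actual a) (Function.update_self _ _ _)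

theorem Realizes.insert_guess (h : Realizes s S) (g : Fin m) :
    Realizes s (insert (fun z => z.2 g) S) := by
  obtain ⟨N, nd, val, hspec, hcount, hval⟩ := h
  exact exists_append hspec hcount hval (U2Node.guess g) (Function.update_self _ _ _)

theorem Realizes.insert_const (h : Realizes s S) (b : Bool) :
    Realizes s (insert (fun _ => b) S) := by
  obtain ⟨N, nd, val, hspec, hcount, hval⟩ := h
  exact exists_append hspec hcount hval (U2Node.const b) (Function.update_self _ _ _)

theorem Realizes.insert_gate (h : Realizes s S) (hu : u ∈ S) (hv : v ∈ S) (a b c : Bool) :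
    Realizes (s + 1) (insert (fun z => xor (xor (u z) a && xor (v z) b) c) S) := by
  obtain ⟨N, nd, val, hspec, hcount, hval⟩ := h
  obtain ⟨j, hj, rfl⟩ := hval u hu
  obtain ⟨k, hk, rfl⟩ := hval v hv
  refine exists_append hspec hcount hval (U2Node.gate a b c j k) ⟨hj, hk, ?_⟩
  rw [Function.update_self, Function.update_of_ne hj.ne, Function.update_of_ne hk.ne]

theorem Realizes.insert_and (h : Realizes s S) (hu : u ∈ S) (hv : v ∈ S) :
    Realizes (s + 1) (insert (fun z => u z && v z) S) := by
  simpa using h.insert_gate hu hv false false false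

theorem Realizes.insert_and_not (h : Realizes s S) (hu : u ∈ S) (hv : v ∈ S) :
    Realizes (s + 1) (insert (fun z => u z && !v z) S) := by
  simpa using h.insert_gate hu hv false true false

theorem Realizes.insert_or (h : Realizes s S) (hu : u ∈ S) (hv : v ∈ S) :
    Realizes (s + 1) (insert (fun z => u z || v z) S) := by
  simpa using h.insert_gate hu hv true true true

theorem Realizes.insert_xor (h : Realizes s S) (hu : u ∈ S) (hv : v ∈ S) :
    Realizes (s + 3) (insert (fun z => xor (u z) (v z)) S) := by
  have h₁ := h.insert_and_not hu hv
  have h₂ := h₁.insert_and_not (Set.mem_insert_of_mem _ hv) (Set.mem_insert_of_mem _ hu)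
  have h₃ := h₂.insert_or (Set.mem_insert_of_mem _ (Set.mem_insert _ _)) (Set.mem_insert _ _)
  refine h₃.mono le_rfl (Set.insert_subset ?_ fun f hf => ?_)
  · refine Set.mem_insert_iff.2 (Or.inl ?_)
    funext z
    cases u z <;> cases v z <;> rfl
  · simp [hf]

theorem Realizes.union_image {ι : Type*} (T : Finset ι)
    (w : ι → (Fin n → Bool) × (Fin m → Bool) → Bool) (cost : ι → ℕ) (h : Realizes s S)
    (hstep : ∀ i ∈ T, ∀ s S', S ⊆ S' → Realizes s S' → Realizes (s + cost i) (insert (w i) S')) :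
    Realizes (s + ∑ i ∈ T, cost i) (S ∪ w '' T) := by
  classical
  induction T using Finset.induction_on with
  | empty => simpa using h
  | insert i T hi ih =>
    have ih := ih fun j hj => hstep j (Finset.mem_insert_of_mem hj)
    have := hstep i (Finset.mem_insert_self i T) _ _ Set.subset_union_left ih
    rw [Finset.sum_insert hi, Finset.coe_insert, Set.image_insert_eq, Set.union_insert]
    exact this.mono (by omega) le_rfl

theorem Realizes.insert_any {ι : Type*} (T : Finset ι)
    {w : ι → (Fin n → Bool) × (Fin m → Bool) → Bool} (h : Realizes s S) (hw : ∀ i ∈ T, w i ∈ S) :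
    Realizes (s + T.card) (insert (anyOf T w) S) := by
  classical
  induction T using Finset.induction_on with
  | empty =>
    have h₀ : anyOf ∅ w = fun _ => false := by
      funext z
      simp [anyOf]
    simpa [h₀] using h.insert_const false
  | insert i T hi ih =>
    have ih := ih fun j hj => hw j (Finset.mem_insert_of_mem hj)
    have := ih.insert_or (Set.mem_insert_of_mem _ (hw i (Finset.mem_insert_self i T)))
      (Set.mem_insert _ _)
    rw [Finset.card_insert_of_notMem hi]
    refine this.mono (by omega) (Set.insert_subset ?_ fun f hf => by simp [hf])
    refine Set.mem_insert_iff.2 (Or.inl ?_)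
    funext z
    rw [Bool.eq_iff_iff]
    simp [anyOf]

theorem Realizes.insert_parity {ι : Type*} {T : Finset ι} (hT : T.Nonempty)
    {w : ι → (Fin n → Bool) × (Fin m → Bool) → Bool} (h : Realizes s S) (hw : ∀ i ∈ T, w i ∈ S) :
    Realizes (s + 3 * (T.card - 1))
      (insert (fun z => decide (∑ i ∈ T, bitZ (w i z) ≠ 0)) S) := by
  classical
  induction hT using Finset.Nonempty.cons_induction with
  | singleton i =>
    have hi : (fun z => decide (∑ i ∈ {i}, bitZ (w i z) ≠ 0)) = w i := by
      funext z
      rw [Finset.sum_singleton]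
      cases w i z <;> decide
    rw [hi, Set.insert_eq_of_mem (hw i (Finset.mem_singleton_self i))]
    simpa using h
  | cons i T hi hT ih =>
    have ih := ih fun j hj => hw j (Finset.mem_cons_of_mem hj)
    have := ih.insert_xor (Set.mem_insert_of_mem _ (hw i (Finset.mem_cons_self i T)))
      (Set.mem_insert _ _)
    have hpos := hT.card_pos
    rw [Finset.card_cons]
    refine this.mono (by omega) (Set.insert_subset ?_ fun f hf => by simp [hf])
    refine Set.mem_insert_iff.2 (Or.inl ?_)
    funext z
    rw [Finset.sum_cons]
    have hxor : ∀ (b : Bool) (t : ZMod 2), decide (bitZ b + t ≠ 0) = xor b (decide (t ≠ 0)) := by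
      decide
    exact hxor _ _

theorem realizes_actuals : Realizes (n := n) (m := m) 0 (Set.range fun a z => z.1 a) := by
  have := (realizes_empty (n := n) (m := m)).union_image Finset.univ (fun a z => z.1 a)
    (fun _ => 0) fun a _ s S' _ h => h.insert_actual a
  simpa using this

end Realizes

section BlockOrCircuits

variable {n : ℕ} {κ : Type*} [DecidableEq κ] {blk : Fin n → κ} {B : Finset κ}

theorem sum_card_fibers (h : ∀ i, blk i ∈ B) : ∑ b ∈ B, ({i | blk i = b} : Finset (Fin n)).card = n := by
  rw [← Finset.card_eq_sum_card_fiberwise fun i _ => h i, Finset.card_univ, Fintype.card_fin]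

theorem realizes_blockOr (hB : ∀ b ∈ B, ∃ i, blk i = b) (h : ∀ i, blk i ∈ B) :
    Realizes (n := n) (m := 0) (3 * n)
      {fun z => blockOr blk Finset.univ B (fun _ => 0) z.1} := by
  have h₁ := (realizes_actuals (n := n) (m := 0)).union_image B
    (fun b z => decide (∑ i with blk i = b, bitZ (z.1 i) ≠ 0))
    (fun b => 3 * (({i | blk i = b} : Finset (Fin n)).card - 1)) fun b hb s S' hS' hr => by
      obtain ⟨i, hi⟩ := hB b hb
      exact hr.insert_parity ⟨i, by simpa using hi⟩ (w := fun i z => z.1 i)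
        fun i _ => hS' ⟨i, rfl⟩
  have h₂ := h₁.insert_any B (w := fun b z => decide (∑ i with blk i = b, bitZ (z.1 i) ≠ 0))
    fun b hb => Or.inr ⟨b, hb, rfl⟩
  refine h₂.mono ?_ (Set.singleton_subset_iff.2 (Set.mem_insert_iff.2 (Or.inl ?_)))
  · rw [zero_add, Finset.card_eq_sum_ones, ← Finset.sum_add_distrib]
    refine le_of_le_of_eq (Finset.sum_le_sum
      (g := fun b => 3 * ({i | blk i = b} : Finset (Fin n)).card) fun b hb => ?_)
      (by rw [← Finset.mul_sum, sum_card_fibers h])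
    obtain ⟨i, hi⟩ := hB b hb
    have : 0 < ({i | blk i = b} : Finset (Fin n)).card :=
      Finset.card_pos.2 ⟨i, by simpa using hi⟩
    omega
  · funext z
    simp [blockOr, anyOf]

end BlockOrCircuits

section Selection

variable {n m : ℕ}

/-- The `k`-th guess input, or `false` if there is none. -/
def guessAt (k : ℕ) (z : (Fin n → Bool) × (Fin m → Bool)) : Bool :=
  if h : k < m then z.2 ⟨k, h⟩ else false

/-- Whether one of the first `k` guess inputs is set. -/
def guessBefore (k : ℕ) (z : (Fin n → Bool) × (Fin m → Bool)) : Bool :=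
  decide (∃ b < k, guessAt b z = true)

/-- Whether `k` is the index of the first guess input that is set. -/
def firstGuess (k : ℕ) (z : (Fin n → Bool) × (Fin m → Bool)) : Bool :=
  guessAt k z && !guessBefore k z

theorem firstGuess_eq_true_iff {k : ℕ} {z : (Fin n → Bool) × (Fin m → Bool)} :
    firstGuess k z = true ↔ guessAt k z = true ∧ ∀ b < k, guessAt b z = false := by
  simp [firstGuess, guessBefore]

theorem firstGuess_unique {k l : ℕ} {z : (Fin n → Bool) × (Fin m → Bool)}
    (hk : firstGuess k z = true) (hl : firstGuess l z = true) : k = l := by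
  rw [firstGuess_eq_true_iff] at hk hl
  rcases lt_trichotomy k l with h | h | h
  · simp [hl.2 k h] at hk
  · exact h
  · simp [hk.2 l h] at hl

theorem realizes_firstGuess {s : ℕ} {S : Set ((Fin n → Bool) × (Fin m → Bool) → Bool)}
    (h : Realizes s S) : ∀ k ≤ m, Realizes (s + 2 * k)
      (insert (guessBefore k) (S ∪ firstGuess '' Set.Iio k)) := by
  intro k
  induction k with
  | zero =>
    intro _
    have h₀ : guessBefore (n := n) (m := m) 0 = fun _ => false := by
      funext z
      simp [guessBefore]
    simpa [h₀] using h.insert_const false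
  | succ k ih =>
    intro hk
    have hg : (fun z : (Fin n → Bool) × (Fin m → Bool) => z.2 ⟨k, hk⟩) = guessAt k := by
      funext z
      rw [guessAt, dif_pos (show k < m from hk)]
    have h₁ := (ih (by omega)).insert_guess ⟨k, hk⟩
    rw [hg] at h₁
    have h₂ := h₁.insert_and_not (Set.mem_insert _ _)
      (Set.mem_insert_of_mem _ (Set.mem_insert _ _))
    have h₃ := h₂.insert_or (Set.mem_insert_of_mem _ (Set.mem_insert _ _))
      (Set.mem_insert_of_mem _ (Set.mem_insert_of_mem _ (Set.mem_insert _ _)))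
    refine h₃.mono (by omega) ?_
    rintro f (rfl | hf | ⟨l, hl, rfl⟩)
    · refine Or.inl ?_
      funext z
      rw [Bool.eq_iff_iff]
      simp only [guessBefore, Nat.lt_succ_iff_lt_or_eq, Bool.or_eq_true, decide_eq_true_eq]
      constructor
      · rintro ⟨b, hb | rfl, hz⟩
        · exact Or.inr ⟨b, hb, hz⟩
        · exact Or.inl hz
      · rintro (hz | ⟨b, hb, hz⟩)
        · exact ⟨k, Or.inr rfl, hz⟩
        · exact ⟨b, Or.inl hb, hz⟩
    · simp [hf]
    · rcases Nat.lt_succ_iff_lt_or_eq.1 hl with hl | rfl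
      · refine Or.inr (Or.inr (Or.inr (Or.inr (Or.inr ⟨l, hl, rfl⟩))))
      · exact Or.inr (Or.inl rfl)

theorem bitZ_anyOf {α ι : Type*} (T : Finset ι) (w : ι → α → Bool) (z : α)
    (hq : ∀ i ∈ T, ∀ j ∈ T, w i z = true → w j z = true → i = j) :
    bitZ (anyOf T w z) = ∑ i ∈ T, bitZ (w i z) := by
  unfold anyOf
  by_cases h : ∃ i ∈ T, w i z = true
  · obtain ⟨i, hi, hqi⟩ := id h
    rw [Finset.sum_eq_single_of_mem i hi fun j hj hji => ?_, hqi, decide_eq_true h]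
    have : w j z ≠ true := fun hqj => hji (hq j hj i hi hqj hqi)
    simp [bitZ, this]
  · rw [decide_eq_false h, Finset.sum_eq_zero]
    · simp [bitZ]
    · intro i hi
      have : w i z ≠ true := fun hqi => h ⟨i, hi, hqi⟩
      simp [bitZ, this]

variable {blk col : Fin n → ℕ} {C : Finset ℕ}

/-- The disjunction of the variables in column `j`, each masked by the selector of its block. -/
def columnEntry (blk col : Fin n → ℕ) (j : ℕ) : (Fin n → Bool) × (Fin m → Bool) → Bool :=
  anyOf {i | col i = j} fun i z => firstGuess (blk i) z && z.1 i

/-- The parity over all columns of the entry of the column in the guessed block. -/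
def selectedParity (blk col : Fin n → ℕ) (C : Finset ℕ)
    (z : (Fin n → Bool) × (Fin m → Bool)) : Bool :=
  decide (∑ j ∈ C, bitZ (columnEntry blk col j z) ≠ 0)

theorem realizes_selectedParity (hblk : ∀ i, blk i < m) (hcol : ∀ i, col i ∈ C)
    (hC : C.Nonempty) : Realizes (n := n) (m := m) (2 * m + 2 * n + 3 * (C.card - 1))
      {selectedParity blk col C} := by
  have h₁ := realizes_firstGuess (realizes_actuals (n := n) (m := m)) m le_rfl
  have h₂ := h₁.union_image Finset.univ (fun i z => firstGuess (blk i) z && z.1 i)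
    (fun _ => 1) fun i _ s S' hS' h =>
      h.insert_and (hS' (Or.inr (Or.inr ⟨blk i, hblk i, rfl⟩))) (hS' (Or.inr (Or.inl ⟨i, rfl⟩)))
  have h₃ := h₂.union_image C (columnEntry blk col) (fun j => ({i | col i = j} : Finset (Fin n)).card)
    fun j _ s S' hS' h => h.insert_any {i | col i = j}
      (w := fun i z => firstGuess (blk i) z && z.1 i)
      fun i _ => hS' (Or.inr ⟨i, Finset.mem_coe.2 (Finset.mem_univ i), rfl⟩)
  have h₄ := h₃.insert_parity hC (w := columnEntry blk col) fun j hj => Or.inr ⟨j, hj, rfl⟩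
  refine h₄.mono ?_ (Set.singleton_subset_iff.2 (Set.mem_insert _ _))
  rw [sum_card_fibers hcol]
  simp
  omega

theorem selectedParity_eq (hcol : ∀ i, col i ∈ C)
    (hinj : ∀ i j, blk i = blk j → col i = col j → i = j)
    (z : (Fin n → Bool) × (Fin m → Bool)) :
    selectedParity blk col C z = decide (∑ i, bitZ (firstGuess (blk i) z && z.1 i) ≠ 0) := by
  rw [selectedParity, ← Finset.sum_fiberwise_of_maps_to (t := C) fun i _ => hcol i]
  congr 3
  funext j
  refine bitZ_anyOf {i | col i = j} (fun i z => firstGuess (blk i) z && z.1 i) z fun i hi k hk hqi hqk => ?_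
  rw [Bool.and_eq_true] at hqi hqk
  refine hinj i k (firstGuess_unique hqi.1 hqk.1) ?_
  rw [(Finset.mem_filter.1 hi).2, (Finset.mem_filter.1 hk).2]

theorem sum_bitZ_firstGuess {b : ℕ} {z : (Fin n → Bool) × (Fin m → Bool)}
    (hb : firstGuess b z = true) :
    ∑ i, bitZ (firstGuess (blk i) z && z.1 i) = ∑ i with blk i = b, bitZ (z.1 i) := by
  rw [Finset.sum_filter]
  refine Finset.sum_congr rfl fun i _ => ?_
  by_cases h : blk i = b
  · simp [h, hb]
  · have : firstGuess (blk i) z ≠ true := fun h' => h (firstGuess_unique h' hb)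
    simp [h, this, bitZ]

theorem blockOr_eq_true_iff_exists_guess (hcol : ∀ i, col i ∈ C)
    (hinj : ∀ i j, blk i = blk j → col i = col j → i = j) (x : Fin n → Bool) :
    blockOr blk Finset.univ (Finset.range m) (fun _ => 0) x = true ↔
      ∃ y : Fin m → Bool, selectedParity blk col C (x, y) = true := by
  simp only [selectedParity_eq hcol hinj, blockOr, decide_eq_true_eq, zero_add, Finset.mem_range]
  constructor
  · rintro ⟨b, hb, hne⟩
    refine ⟨fun i => decide ((i : ℕ) = b), ?_⟩
    rwa [sum_bitZ_firstGuess (b := b)]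
    rw [firstGuess_eq_true_iff]
    refine ⟨by simp [guessAt, hb], fun l hl => ?_⟩
    simp [guessAt, hl.ne]
  · rintro ⟨y, hne⟩
    obtain ⟨i, -, hi⟩ := Finset.exists_ne_zero_of_sum_ne_zero hne
    have hfirst : firstGuess (blk i) (x, y) = true := by
      by_contra h
      simp [h, bitZ] at hi
    refine ⟨blk i, ?_, by rwa [sum_bitZ_firstGuess hfirst] at hne⟩
    by_contra h
    have := (firstGuess_eq_true_iff.1 hfirst).1
    simp [guessAt, h] at this

end Selection

theorem three_mul_card_le_sizeDC {n : ℕ} {κ : Type*} [DecidableEq κ] {blk : Fin n → κ}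
    {B : Finset κ} (hB : ∀ b ∈ B, 2 ≤ ({i | blk i = b} : Finset (Fin n)).card)
    (h : ∀ i, blk i ∈ B) (hne : ∃ c : U2Circuit n 0,
      c.Computes (blockOr blk Finset.univ B fun _ => 0)) :
    3 * n ≤ sizeDC (blockOr blk Finset.univ B fun _ => 0) + 3 * B.card := by
  obtain ⟨c, hc⟩ := hne
  obtain ⟨c, hc, hs⟩ := Nat.sInf_mem (s := {s : ℕ | ∃ c : U2Circuit n 0,
    c.Computes (blockOr blk Finset.univ B fun _ => 0) ∧ c.size = s}) ⟨_, c, hc, rfl⟩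
  have := hc.cover.card_le_of_blockOr hB fun i _ => h i
  rw [Finset.card_univ, Fintype.card_fin] at this
  rw [sizeDC]
  omega

theorem exists_circuit_blockOr {n : ℕ} {κ : Type*} [DecidableEq κ] {blk : Fin n → κ}
    {B : Finset κ} (hB : ∀ b ∈ B, ∃ i, blk i = b) (h : ∀ i, blk i ∈ B) :
    ∃ c : U2Circuit n 0, c.Computes (blockOr blk Finset.univ B fun _ => 0) ∧ c.size ≤ 3 * n := by
  obtain ⟨c, hs, hc⟩ := (realizes_blockOr hB h).exists_circuit (Set.mem_singleton _)
  refine ⟨c, fun x => ?_, hs⟩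
  simp [hc]

theorem sizeNDC_blockOr_le {n m : ℕ} {blk col : Fin n → ℕ} {C : Finset ℕ}
    (hblk : ∀ i, blk i < m) (hcol : ∀ i, col i ∈ C) (hC : C.Nonempty)
    (hinj : ∀ i j, blk i = blk j → col i = col j → i = j) :
    sizeNDC (blockOr blk Finset.univ (Finset.range m) fun _ => 0) ≤
      2 * m + 2 * n + 3 * (C.card - 1) := by
  obtain ⟨c, hs, hc⟩ := (realizes_selectedParity hblk hcol hC).exists_circuit
    (Set.mem_singleton _)
  have hcomp : c.Computes (blockOr blk Finset.univ (Finset.range m) fun _ => 0) := by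
    intro x
    simp only [hc]
    exact blockOr_eq_true_iff_exists_guess hcol hinj x
  exact le_trans (Nat.sInf_le ⟨m, c, hcomp, rfl⟩) hs

theorem tendsto_sqrt_add_div (a b : ℝ) :
    Filter.Tendsto (fun n : ℕ => (a * (n.sqrt : ℝ) + b) / (n : ℝ)) Filter.atTop (nhds 0) := by
  have hsqrt : Filter.Tendsto (fun n : ℕ => (n.sqrt : ℝ) / (n : ℝ)) Filter.atTop (nhds 0) := by
    have hinv : Filter.Tendsto (fun n : ℕ => (√(n : ℝ))⁻¹) Filter.atTop (nhds 0) :=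
      tendsto_inv_atTop_zero.comp (Real.tendsto_sqrt_atTop.comp tendsto_natCast_atTop_atTop)
    refine squeeze_zero (fun n => by positivity) (fun n => ?_) hinv
    rw [← Real.sqrt_div_self]
    exact div_le_div_of_nonneg_right Real.nat_sqrt_le_real_sqrt (Nat.cast_nonneg n)
  have h := (hsqrt.const_mul a).add (tendsto_const_div_atTop_nhds_zero_nat b)
  simp only [mul_zero, add_zero] at h
  refine h.congr fun n => ?_
  rw [add_div, mul_div_assoc]

/-- There is a family of Boolean functions `f_n` with
`size^ndc(f_n) ≤ 2n + o(n)` and `size^dc(f_n) = 3n − o(n)`: there are functions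
`g(n) = o(n)` and `h(n) = o(n)` with `size^ndc(f_n) ≤ 2n + g(n)` and
`3n − h(n) ≤ size^dc(f_n) ≤ 3n`. -/
theorem ndc_dc_separation :
    ∃ (f : (n : ℕ) → (Fin n → Bool) → Bool) (g h : ℕ → ℝ),
      Filter.Tendsto (fun n : ℕ => g n / (n : ℝ)) Filter.atTop (nhds 0) ∧
      Filter.Tendsto (fun n : ℕ => h n / (n : ℝ)) Filter.atTop (nhds 0) ∧
      ∀ n : ℕ,
        (sizeNDC (f n) : ℝ) ≤ 2 * (n : ℝ) + g n ∧
        3 * (n : ℝ) - h n ≤ (sizeDC (f n) : ℝ) ∧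
        (sizeDC (f n) : ℝ) ≤ 3 * (n : ℝ) := by
  refine ⟨fun n => blockOr (fun i : Fin n => (i : ℕ) % n.sqrt) Finset.univ
      (Finset.range n.sqrt) fun _ => 0, fun n => 5 * (n.sqrt : ℝ) + 6,
    fun n => 3 * (n.sqrt : ℝ) + 9, tendsto_sqrt_add_div 5 6, tendsto_sqrt_add_div 3 9,
    fun n => ?_⟩
  have hblk : ∀ i : Fin n, (i : ℕ) % n.sqrt < n.sqrt := fun i =>
    Nat.mod_lt _ (Nat.sqrt_pos.2 (lt_of_le_of_lt (Nat.zero_le _) i.isLt))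
  have hmem : ∀ i : Fin n, (i : ℕ) % n.sqrt ∈ Finset.range n.sqrt :=
    fun i => Finset.mem_range.2 (hblk i)
  obtain ⟨c, hc, hsize⟩ := exists_circuit_blockOr (B := Finset.range n.sqrt)
    (blk := fun i : Fin n => (i : ℕ) % n.sqrt) (fun b hb => by
      have hb := Finset.mem_range.1 hb
      exact ⟨⟨b, hb.trans_le (Nat.sqrt_le_self n)⟩, Nat.mod_eq_of_lt hb⟩) hmem
  refine ⟨?_, ?_, ?_⟩
  · have h := sizeNDC_blockOr_le (C := Finset.range (n / n.sqrt + 1))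
      (col := fun i : Fin n => (i : ℕ) / n.sqrt) hblk
      (fun i => Finset.mem_range.2 (Nat.lt_succ_of_le (Nat.div_le_div_right i.isLt.le)))
      ⟨0, by simp⟩ fun i j hr hq => by
        have hi := Nat.div_add_mod (i : ℕ) n.sqrt
        have hj := Nat.div_add_mod (j : ℕ) n.sqrt
        rw [hq, hr, hj] at hi
        exact Fin.ext hi.symm
    have hdiv : n / n.sqrt ≤ n.sqrt + 2 := by
      rcases Nat.eq_zero_or_pos n.sqrt with h0 | hpos
      · simp [h0]
      · rw [← Nat.lt_succ_iff, Nat.div_lt_iff_lt_mul hpos]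
        have := Nat.sqrt_le_add n
        nlinarith
    rw [Finset.card_range] at h
    have h' := h.trans (show _ ≤ 2 * n + (5 * n.sqrt + 6) by omega)
    beta_reduce
    exact_mod_cast h'
  · by_cases hn : n < 4
    · have h₁ : (n : ℝ) ≤ 3 := by exact_mod_cast Nat.lt_succ_iff.1 hn
      have h₂ : (0 : ℝ) ≤ n.sqrt := Nat.cast_nonneg _
      refine le_trans ?_ (Nat.cast_nonneg _)
      linarith
    · have hm : 2 ≤ n.sqrt := Nat.le_sqrt.2 (by omega)
      have hle : n.sqrt * n.sqrt ≤ n := Nat.sqrt_le n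
      have h := three_mul_card_le_sizeDC (B := Finset.range n.sqrt)
        (blk := fun i : Fin n => (i : ℕ) % n.sqrt) (fun b hb => by
          have hb := Finset.mem_range.1 hb
          have hb' : b + n.sqrt < n := by nlinarith
          refine Finset.one_lt_card.2 ⟨⟨b, by omega⟩, ?_, ⟨b + n.sqrt, hb'⟩, ?_, ?_⟩
          · simp [Nat.mod_eq_of_lt hb]
          · simp [Nat.mod_eq_of_lt hb]
          · simp only [ne_eq, Fin.mk.injEq]
            omega) hmem ⟨c, hc⟩
      rw [Finset.card_range] at h
      have h' : (3 * n : ℝ) ≤ (sizeDC (blockOr (fun i : Fin n => (i : ℕ) % n.sqrt) Finset.univ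
        (Finset.range n.sqrt) fun _ => 0) : ℝ) + 3 * n.sqrt := by exact_mod_cast h
      linarith
  · have h := (Nat.sInf_le ⟨c, hc, rfl⟩ : sizeDC (blockOr (fun i : Fin n => (i : ℕ) % n.sqrt)
      Finset.univ (Finset.range n.sqrt) fun _ => 0) ≤ c.size).trans hsize
    exact_mod_cast h
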